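/- Let X be a finite Bruck loop. Then there exist subloops Y and Z of X such that |Y| is odd, every element of Z has order a power of 2, the map Y × Z → X, (y,z) ↦ y∘z, is a bijection, and (y₁∘z₁)∘(y₂∘z₂) = (y₁∘y₂)∘(z₁∘z₂) for all y₁,y₂ ∈ Y and z₁,z₂ ∈ Z; that is, X is the direct product of a Bruck loop Y of odd order and a Bruck loop Z of 2-power exponent. -/

import Mathlib

/-- A Bruck loop: a loop (with two-sided identity and bijective translations) satisfying
the right Bol identity `((x∘y)∘z)∘y = x∘((y∘z)∘y)` and the automorphic inverse property
`(x∘y)⁻¹ = x⁻¹∘y⁻¹`, where `x⁻¹` is the (well-defined) inverse of `x`. -/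
structure BruckLoop (X : Type*) where
  mul : X → X → X
  one : X
  inv : X → X
  one_mul : ∀ x, mul one x = x
  mul_one : ∀ x, mul x one = x
  mulLeft_bijective : ∀ x, Function.Bijective (mul x)
  mulRight_bijective : ∀ x, Function.Bijective fun y => mul y x
  rightBol : ∀ x y z, mul (mul (mul x y) z) y = mul x (mul (mul y z) y)
  mul_inv : ∀ x, mul x (inv x) = one
  inv_mul : ∀ x, mul (inv x) x = one
  aip : ∀ x y, inv (mul x y) = mul (inv x) (inv y)

namespace BruckLoop

variable {X : Type*}

/-- Powers of an element of a Bruck loop (powers are well defined in Bol loops). -/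
def pow (L : BruckLoop X) (x : X) : ℕ → X
  | 0 => L.one
  | n + 1 => L.mul (L.pow x n) x

/-- An element has order a power of `2`. -/
def OrderTwoPow (L : BruckLoop X) (x : X) : Prop := ∃ n : ℕ, L.pow x (2 ^ n) = L.one

/-- A subloop: a nonempty subset closed under the loop operation. -/
def IsSubloop (L : BruckLoop X) (S : Set X) : Prop :=
  S.Nonempty ∧ ∀ a ∈ S, ∀ b ∈ S, L.mul a b ∈ S

/-- The right translation `ρ_x : y ↦ y ∘ x` as a permutation of `X`. -/
noncomputable def rho (L : BruckLoop X) (x : X) : Equiv.Perm X :=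
  Equiv.ofBijective _ (L.mulRight_bijective x)

/-- The enveloping group `G = ⟨ρ_x : x ∈ X⟩` of a Bruck loop. -/
noncomputable def envGroup (L : BruckLoop X) : Subgroup (Equiv.Perm X) :=
  Subgroup.closure (Set.range L.rho)

/-- `H = Stab_G(1)`, the stabilizer of `1` in the enveloping group. -/
noncomputable def innerGroup (L : BruckLoop X) : Subgroup (Equiv.Perm X) :=
  L.envGroup ⊓ MulAction.stabilizer (Equiv.Perm X) L.one

end BruckLoop

theorem Subgroup.exists_mem_normalizer_of_lt_isPGroup {G : Type*} [Group G] [Finite G] {p : ℕ}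
    [Fact p.Prime] {P R : Subgroup G} (hP : IsPGroup p P) (hRP : R < P) :
    ∃ g ∈ P, g ∈ Subgroup.normalizer (R : Set G) ∧ g ∉ R := by
  have := hP.isNilpotent
  have hlt : R.subgroupOf P < ⊤ := by
    rw [lt_top_iff_ne_top, Ne, Subgroup.subgroupOf_eq_top]
    exact hRP.not_ge
  obtain ⟨g, hg, hgR⟩ := SetLike.exists_of_lt (Group.normalizerCondition_of_isNilpotent _ hlt)
  refine ⟨g, g.2, ?_, fun h => hgR (Subgroup.mem_subgroupOf.2 h)⟩
  rw [Subgroup.mem_normalizer_iff] at hg ⊢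
  intro h
  constructor
  · intro hh
    exact (hg ⟨h, hRP.le hh⟩).1 hh
  · intro hh
    have hhP : h ∈ P := by
      have := P.mul_mem (P.mul_mem (P.inv_mem g.2) (hRP.le hh)) g.2
      simpa [mul_assoc] using this
    exact (hg ⟨h, hhP⟩).2 hh

theorem Subgroup.mem_normalizer_closure_of_conj_mem {G : Type*} [Group G] [Finite G] {E : Set G}
    {x : G} (hx : ∀ e ∈ E, x * e * x⁻¹ ∈ E) :
    x ∈ Subgroup.normalizer (Subgroup.closure E : Set G) := by
  have hle : (Subgroup.closure E).map (MulAut.conj x).toMonoidHom ≤ Subgroup.closure E := by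
    rw [MonoidHom.map_closure, Subgroup.closure_le]
    rintro _ ⟨e, he, rfl⟩
    exact Subgroup.subset_closure (hx e he)
  have heq := Subgroup.eq_of_le_of_card_ge hle
    (Nat.card_congr ((Subgroup.closure E).equivMapOfInjective _
      (MulAut.conj x).injective).toEquiv).le
  rw [Subgroup.mem_normalizer_iff]
  intro h
  constructor
  · intro hh
    exact hle ⟨h, hh, rfl⟩
  · intro hh
    rw [← heq] at hh
    obtain ⟨k, hk, hkh⟩ := hh
    rwa [← (MulAut.conj x).injective hkh]

theorem Subgroup.exists_mem_diff_mem_normalizer_closure {G : Type*} [Group G] [Finite G] {p : ℕ}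
    [Fact p.Prime] {D E : Set G} {P : Subgroup G} (hconj : ∀ d ∈ D, ∀ e ∈ D, d * e * d⁻¹ ∈ D)
    (hP : IsPGroup p P) (hEP : Subgroup.closure E ≤ P)
    (hE : D ∩ Subgroup.closure E = E) (hne : ¬ D ∩ P ⊆ E) :
    ∃ x ∈ D, x ∈ P ∧ x ∉ E ∧ x ∈ Subgroup.normalizer (Subgroup.closure E : Set G) := by
  obtain ⟨R, -, hR⟩ := (Set.toFinite {R : Subgroup G | R ≤ P ∧ D ∩ R = E}).exists_le_maximal
    (a := Subgroup.closure E) ⟨hEP, hE⟩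
  obtain ⟨hRP, hRE⟩ := hR.prop
  have hlt : R < P := lt_of_le_of_ne hRP fun h => hne (h ▸ hRE.subset)
  obtain ⟨g, hgP, hgN, hgR⟩ := exists_mem_normalizer_of_lt_isPGroup hP hlt
  have hRN : R ≤ P ⊓ Subgroup.normalizer (R : Set G) := le_inf hRP Subgroup.le_normalizer
  have hnot : ¬ D ∩ (P ⊓ Subgroup.normalizer (R : Set G) : Subgroup G) ⊆ E := by
    intro h
    refine hgR (hR.le_of_ge ⟨inf_le_left, h.antisymm ?_⟩ hRN ⟨hgP, hgN⟩)
    rw [← hRE]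
    exact Set.inter_subset_inter_right _ hRN
  obtain ⟨x, ⟨hxD, hxP, hxN⟩, hxE⟩ := Set.not_subset.1 hnot
  refine ⟨x, hxD, hxP, hxE, Subgroup.mem_normalizer_closure_of_conj_mem fun e he => ?_⟩
  rw [← hRE] at he ⊢
  exact ⟨hconj x hxD e he.1, (Subgroup.mem_normalizer_iff.1 hxN e).1 he.2⟩

/-- The Baer–Suzuki theorem for involutions. -/
theorem Subgroup.isPGroup_closure_of_involutions {G : Type*} [Group G] [Finite G] {D : Set G}
    (hconj : ∀ d ∈ D, ∀ e ∈ D, d * e * d⁻¹ ∈ D) (hinv : ∀ d ∈ D, d * d = 1)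
    (hmul : ∀ d ∈ D, ∀ e ∈ D, ∃ k : ℕ, (d * e) ^ 2 ^ k = 1) :
    IsPGroup 2 (Subgroup.closure D) := by
  have hzp : ∀ g : G, (∃ k : ℕ, g ^ 2 ^ k = 1) → IsPGroup 2 (Subgroup.zpowers g) := by
    rintro g ⟨k, hk⟩
    rw [isPGroup_iff_card_dvd_pow]
    exact ⟨k, by rw [Nat.card_zpowers]; exact orderOf_dvd_of_pow_eq_one hk⟩
  let S : Set (Set G) := {E | E ⊆ D ∧ IsPGroup 2 (Subgroup.closure E)}
  have hext : ∀ E ∈ S, ∃ F, E ⊆ F ∧ Maximal (· ∈ S) F := fun E hE =>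
    (Set.toFinite S).exists_le_maximal hE
  have hclosed : ∀ E, Maximal (· ∈ S) E → D ∩ Subgroup.closure E ⊆ E := by
    intro E hE
    refine hE.le_of_ge ⟨Set.inter_subset_left, hE.prop.2.to_le ?_⟩
      (Set.subset_inter hE.prop.1 Subgroup.subset_closure)
    exact (Subgroup.closure_le _).2 Set.inter_subset_right
  have huniq : ∀ E F, Maximal (· ∈ S) E → Maximal (· ∈ S) F → E = F := by
    by_contra! hcon
    obtain ⟨E₀, F₀, hE₀, hF₀, hne₀⟩ := hcon
    obtain ⟨⟨E, F⟩, ⟨hE, hF, hne⟩, hmax⟩ := Set.exists_max_image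
      {q : Set G × Set G | Maximal (· ∈ S) q.1 ∧ Maximal (· ∈ S) q.2 ∧ q.1 ≠ q.2}
      (fun q => (q.1 ∩ q.2).ncard) (Set.toFinite _) ⟨(E₀, F₀), hE₀, hF₀, hne₀⟩
    dsimp only at hE hF hne hmax
    have hEF : D ∩ Subgroup.closure (E ∩ F) = E ∩ F := by
      apply Set.Subset.antisymm
      · intro d hd
        exact ⟨hclosed E hE ⟨hd.1, Subgroup.closure_mono Set.inter_subset_left hd.2⟩,
          hclosed F hF ⟨hd.1, Subgroup.closure_mono Set.inter_subset_right hd.2⟩⟩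
      · exact fun d hd => ⟨hE.prop.1 hd.1, Subgroup.subset_closure hd⟩
    obtain ⟨x, hxD, hxE, hxEF, hxN⟩ := exists_mem_diff_mem_normalizer_closure hconj hE.prop.2
      (Subgroup.closure_mono Set.inter_subset_left) hEF fun h =>
        hne (hE.eq_of_subset hF.prop fun d hd => (h ⟨hE.prop.1 hd, Subgroup.subset_closure hd⟩).2)
    obtain ⟨y, hyD, hyF, hyEF, hyN⟩ := exists_mem_diff_mem_normalizer_closure hconj hF.prop.2
      (Subgroup.closure_mono Set.inter_subset_right) hEF fun h =>
        hne (hF.eq_of_subset hE.prop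
          fun d hd => (h ⟨hF.prop.1 hd, Subgroup.subset_closure hd⟩).1).symm
    have hxE := hclosed E hE ⟨hxD, hxE⟩
    have hyF := hclosed F hF ⟨hyD, hyF⟩
    have hxx : x⁻¹ = x := inv_eq_of_mul_eq_one_left (hinv x hxD)
    have hyy : y⁻¹ = y := inv_eq_of_mul_eq_one_left (hinv y hyD)
    have hT : IsPGroup 2 (Subgroup.zpowers x ⊔ Subgroup.zpowers (x * y) : Subgroup G) := by
      refine (hzp x ⟨1, by simpa [pow_two] using hinv x hxD⟩).to_sup_of_normal_right'
        (hzp _ (hmul x hxD y hyD)) ?_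
      rw [Subgroup.zpowers_le, ← Subgroup.closure_eq (Subgroup.zpowers (x * y))]
      refine Subgroup.mem_normalizer_closure_of_conj_mem ?_
      rintro _ ⟨n, rfl⟩
      refine ⟨-n, ?_⟩
      have : x * (x * y) * x⁻¹ = (x * y)⁻¹ := by
        rw [mul_inv_rev, hyy, hxx, ← mul_assoc, hinv x hxD, one_mul]
      simp only
      rw [← conj_zpow, this, inv_zpow']
    have hR : IsPGroup 2 (Subgroup.closure (E ∩ F) ⊔
        (Subgroup.zpowers x ⊔ Subgroup.zpowers (x * y)) : Subgroup G) := by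
      refine (hE.prop.2.to_le (Subgroup.closure_mono Set.inter_subset_left)).to_sup_of_normal_left'
        hT ?_
      exact sup_le (Subgroup.zpowers_le.2 hxN) (Subgroup.zpowers_le.2 (mul_mem hxN hyN))
    have hxT : x ∈ Subgroup.zpowers x ⊔ Subgroup.zpowers (x * y) :=
      Subgroup.mem_sup_left (Subgroup.mem_zpowers x)
    have hyT : y ∈ Subgroup.zpowers x ⊔ Subgroup.zpowers (x * y) := by
      have := mul_mem (inv_mem hxT) (Subgroup.mem_sup_right (S := Subgroup.zpowers x)
        (Subgroup.mem_zpowers (x * y)))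
      simpa using this
    obtain ⟨M, hM, hMmax⟩ := hext (insert x (insert y (E ∩ F))) ⟨by
        rintro d (rfl | rfl | hd)
        exacts [hxD, hyD, hE.prop.1 hd.1], hR.to_le ((Subgroup.closure_le _).2 (by
        rintro d (rfl | rfl | hd)
        exacts [Subgroup.mem_sup_right hxT, Subgroup.mem_sup_right hyT,
          Subgroup.mem_sup_left (Subgroup.subset_closure hd)]))⟩
    have hkey : ∀ A, Maximal (· ∈ S) A → ∀ d ∈ A, d ∈ M → d ∉ E ∩ F → E ∩ F ⊆ A → M = A := by
      intro A hA d hdA hdM hd hsub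
      by_contra hMA
      refine (hmax (M, A) ⟨hMmax, hA, hMA⟩).not_gt (Set.ncard_lt_ncard ?_)
      refine (Set.ssubset_iff_of_subset ?_).2 ⟨d, ⟨hdM, hdA⟩, hd⟩
      exact fun e he => ⟨hM (by simp [he.1, he.2]), hsub he⟩
    exact hne ((hkey E hE x hxE (hM (by simp)) hxEF Set.inter_subset_left).symm.trans
      (hkey F hF y hyF (hM (by simp)) hyEF Set.inter_subset_right))
  obtain ⟨M, -, hM⟩ := hext ∅ ⟨Set.empty_subset _, by
    rw [Subgroup.closure_empty]; exact IsPGroup.of_bot⟩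
  refine hM.prop.2.to_le (Subgroup.closure_mono fun d hd => ?_)
  obtain ⟨N, hN, hNmax⟩ := hext {d} ⟨by simpa using hd, by
    rw [← Subgroup.zpowers_eq_closure]
    exact hzp d ⟨1, by simpa [pow_two] using hinv d hd⟩⟩
  rw [huniq M N hM hNmax]
  exact hN rfl

/-- In a finite group that is a `2`-group modulo its center, the elements of `2`-power order are
closed under multiplication. -/
theorem exists_mul_pow_two_pow_eq_one {M : Type*} [Group M] [Finite M]
    (hM : ∀ g : M, ∃ k : ℕ, g ^ 2 ^ k ∈ Subgroup.center M) {a b : M}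
    (ha : ∃ k : ℕ, a ^ 2 ^ k = 1) (hb : ∃ k : ℕ, b ^ 2 ^ k = 1) : ∃ k : ℕ, (a * b) ^ 2 ^ k = 1 := by
  have hp : IsPGroup 2 (M ⧸ Subgroup.center M) := by
    rw [isPGroup_iff_pow_pow_eq_one]
    intro q
    induction q using QuotientGroup.induction_on with | _ g =>
    obtain ⟨k, hk⟩ := hM g
    exact ⟨k, by rwa [← QuotientGroup.mk_pow, QuotientGroup.eq_one_iff]⟩
  obtain ⟨n, hn⟩ := IsPGroup.iff_card.1 hp
  obtain ⟨k, hk⟩ := ha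
  obtain ⟨l, hl⟩ := hb
  have hV : ∀ g : M, ∀ k : ℕ, g ^ 2 ^ k = 1 → ∀ l,
      MonoidHom.transferCenterPow M g ^ 2 ^ (k + l) = 1 := by
    intro g k hg l
    rw [pow_add, pow_mul, ← map_pow, hg, map_one, one_pow]
  refine ⟨n + (k + l), ?_⟩
  have h1 : MonoidHom.transferCenterPow M (a * b) ^ 2 ^ (k + l) = 1 := by
    have hc : Commute (MonoidHom.transferCenterPow M a) (MonoidHom.transferCenterPow M b) :=
      Subtype.ext (Subgroup.mem_center_iff.1 (MonoidHom.transferCenterPow M b).2 _)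
    rw [map_mul, hc.mul_pow, hV a k hk, add_comm k l, hV b l hl, one_mul]
  have h2 := congrArg Subtype.val h1
  rw [Subgroup.coe_pow, MonoidHom.transferCenterPow_apply, Subgroup.index_eq_card, hn] at h2
  rw [pow_add, pow_mul]
  exact h2

/-- An element of odd order. -/
def IsOddElt {M : Type*} [Monoid M] (g : M) : Prop := ∃ m : ℕ, Odd m ∧ g ^ m = 1

/-- An element whose order is a power of `2`. -/
def IsTwoElt {M : Type*} [Monoid M] (g : M) : Prop := ∃ k : ℕ, g ^ 2 ^ k = 1

theorem Odd.exists_modEq_one_modEq_zero {m : ℕ} (hm : Odd m) (k : ℕ) :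
    ∃ N, N ≡ 1 [MOD m] ∧ N ≡ 0 [MOD 2 ^ k] :=
  let N := Nat.chineseRemainder (Nat.Coprime.pow_right k hm.coprime_two_right) 1 0
  ⟨N, N.2⟩

theorem pow_eq_self_of_modEq_one {M : Type*} [Monoid M] {g : M} {m N : ℕ} (hg : g ^ m = 1)
    (hN : N ≡ 1 [MOD m]) : g ^ N = g := by
  simpa using pow_eq_pow_of_modEq hN hg

theorem pow_eq_one_of_modEq_zero {M : Type*} [Monoid M] {g : M} {m N : ℕ} (hg : g ^ m = 1)
    (hN : N ≡ 0 [MOD m]) : g ^ N = 1 := by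
  simpa using pow_eq_pow_of_modEq hN hg

theorem exists_pow_mul_pow_eq {G : Type*} [Group G] [Finite G] (g : G) :
    ∃ i j : ℕ, IsOddElt (g ^ i) ∧ IsTwoElt (g ^ j) ∧ g ^ i * g ^ j = g := by
  obtain ⟨k, m, hm, hkm⟩ := Nat.exists_eq_two_pow_mul_odd (orderOf_pos g).ne'
  have hg : g ^ (2 ^ k * m) = 1 := hkm ▸ pow_orderOf_eq_one g
  have hco : Nat.Coprime m (2 ^ k) := Nat.Coprime.pow_right k hm.coprime_two_right
  obtain ⟨N, h1, h0⟩ := hm.exists_modEq_one_modEq_zero k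
  obtain ⟨N', h0', h1'⟩ := Nat.chineseRemainder hco 0 1
  refine ⟨N, N', ⟨m, hm, ?_⟩, ⟨k, ?_⟩, ?_⟩
  · obtain ⟨c, rfl⟩ := (Nat.modEq_zero_iff_dvd).1 h0
    rw [← pow_mul, mul_right_comm, pow_mul, hg, one_pow]
  · obtain ⟨c, rfl⟩ := (Nat.modEq_zero_iff_dvd).1 h0'
    rw [← pow_mul, mul_right_comm, mul_comm m, pow_mul, hg, one_pow]
  · rw [← pow_add]
    refine pow_eq_self_of_modEq_one hg ?_
    rw [mul_comm, ← Nat.modEq_and_modEq_iff_modEq_mul hco]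
    exact ⟨by simpa using h1.add h0', by simpa using h0.add h1'⟩

theorem IsOddElt.pow {M : Type*} [Monoid M] {g : M} (hg : IsOddElt g) (n : ℕ) :
    IsOddElt (g ^ n) := by
  obtain ⟨m, hm, hgm⟩ := hg
  exact ⟨m, hm, by rw [← pow_mul, mul_comm, pow_mul, hgm, one_pow]⟩

theorem IsTwoElt.pow {M : Type*} [Monoid M] {g : M} (hg : IsTwoElt g) (n : ℕ) :
    IsTwoElt (g ^ n) := by
  obtain ⟨m, hgm⟩ := hg
  exact ⟨m, by rw [← pow_mul, mul_comm, pow_mul, hgm, one_pow]⟩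

theorem IsTwoElt.of_pow_two {M : Type*} [Monoid M] {g : M} (hg : IsTwoElt (g ^ 2)) :
    IsTwoElt g := by
  obtain ⟨k, hk⟩ := hg
  exact ⟨k + 1, by rwa [pow_succ', pow_mul]⟩

theorem isOddElt_one {M : Type*} [Monoid M] : IsOddElt (1 : M) := ⟨1, odd_one, one_pow _⟩

theorem isTwoElt_one {M : Type*} [Monoid M] : IsTwoElt (1 : M) := ⟨0, one_pow _⟩

theorem IsOddElt.inv {G : Type*} [Group G] {g : G} (hg : IsOddElt g) : IsOddElt g⁻¹ := by
  obtain ⟨m, hm, hgm⟩ := hg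
  exact ⟨m, hm, by rw [inv_pow, hgm, inv_one]⟩

theorem IsOddElt.conj {G : Type*} [Group G] {g : G} (hg : IsOddElt g) (h : G) :
    IsOddElt (h * g * h⁻¹) := by
  obtain ⟨m, hm, hgm⟩ := hg
  exact ⟨m, hm, by rw [conj_pow, hgm, mul_one, mul_inv_cancel]⟩

theorem IsTwoElt.conj {G : Type*} [Group G] {g : G} (hg : IsTwoElt g) (h : G) :
    IsTwoElt (h * g * h⁻¹) := by
  obtain ⟨m, hgm⟩ := hg
  exact ⟨m, by rw [conj_pow, hgm, mul_one, mul_inv_cancel]⟩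

theorem IsTwoElt.mul_of_commute {M : Type*} [Monoid M] {a b : M} (ha : IsTwoElt a)
    (hb : IsTwoElt b) (hab : Commute a b) : IsTwoElt (a * b) := by
  obtain ⟨k, hk⟩ := ha
  obtain ⟨l, hl⟩ := hb
  refine ⟨k + l, ?_⟩
  rw [hab.mul_pow, pow_add, pow_mul, hk, one_pow, mul_comm (2 ^ k), pow_mul, hl, one_pow, one_mul]

theorem IsTwoElt.eq_one_of_odd_pow {M : Type*} [Monoid M] {a : M} (ha : IsTwoElt a) {m : ℕ}
    (hm : Odd m) (ham : a ^ m = 1) : a = 1 := by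
  obtain ⟨k, hk⟩ := ha
  obtain ⟨N, h1, h0⟩ := hm.exists_modEq_one_modEq_zero k
  rw [← pow_eq_self_of_modEq_one ham h1, pow_eq_one_of_modEq_zero hk h0]

theorem IsOddElt.exists_pow_mul_eq {M : Type*} [Monoid M] {u z : M} (hu : IsOddElt u)
    (hz : IsTwoElt z) (huz : Commute u z) : ∃ N : ℕ, (u * z) ^ N = u := by
  obtain ⟨m, hm, hum⟩ := hu
  obtain ⟨k, hk⟩ := hz
  obtain ⟨N, h1, h0⟩ := hm.exists_modEq_one_modEq_zero k
  exact ⟨N, by rw [huz.mul_pow, pow_eq_self_of_modEq_one hum h1, pow_eq_one_of_modEq_zero hk h0,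
    mul_one]⟩

theorem IsOddElt.eq_of_mul_eq_mul {M : Type*} [Monoid M] {u z u' z' : M} (hu : IsOddElt u)
    (hz : IsTwoElt z) (huz : Commute u z) (hu' : IsOddElt u') (hz' : IsTwoElt z')
    (huz' : Commute u' z') (h : u * z = u' * z') : u = u' := by
  obtain ⟨m, hm, hum⟩ := hu
  obtain ⟨k, hk⟩ := hz
  obtain ⟨m', hm', hum'⟩ := hu'
  obtain ⟨k', hk'⟩ := hz'
  obtain ⟨N, h1, h0⟩ := (hm.mul hm').exists_modEq_one_modEq_zero (k + k')
  rw [pow_add] at h0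
  have h2 := congrArg (· ^ N) h
  simp only [huz.mul_pow, huz'.mul_pow] at h2
  rwa [pow_eq_self_of_modEq_one hum (h1.of_mul_right _), pow_eq_one_of_modEq_zero hk
    (h0.of_mul_right _), pow_eq_self_of_modEq_one hum' (h1.of_mul_left _),
    pow_eq_one_of_modEq_zero hk' (h0.of_mul_left _), mul_one, mul_one] at h2

theorem IsOddElt.exists_pow_pow_two_eq {M : Type*} [Monoid M] {u : M} (hu : IsOddElt u) :
    ∃ n : ℕ, (u ^ 2) ^ n = u := by
  obtain ⟨m, ⟨r, rfl⟩, hum⟩ := hu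
  refine ⟨r + 1, ?_⟩
  rw [← pow_mul, show 2 * (r + 1) = (2 * r + 1) + 1 by ring, pow_succ, hum, one_mul]

namespace BruckLoop

variable {X : Type*} (L : BruckLoop X)

theorem rho_apply (x y : X) : L.rho x y = L.mul y x := rfl

theorem rho_apply_one (x : X) : L.rho x L.one = x := L.one_mul x

theorem rho_injective : Function.Injective L.rho := fun x y h => by
  rw [← L.rho_apply_one x, h, rho_apply_one]

theorem rho_one : L.rho L.one = 1 := Equiv.ext L.mul_one

theorem inv_inv (x : X) : L.inv (L.inv x) = x :=
  (L.mulLeft_bijective (L.inv x)).1 ((L.mul_inv _).trans (L.inv_mul x).symm)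

theorem rho_mul_rho_mul_rho (x y : X) :
    L.rho y * L.rho x * L.rho y = L.rho (L.mul (L.mul y x) y) :=
  Equiv.ext fun z => L.rightBol z y x

theorem rho_inv (x : X) : L.rho (L.inv x) = (L.rho x)⁻¹ := by
  have h := L.rho_mul_rho_mul_rho (L.inv x) x
  rw [L.mul_inv, L.one_mul, mul_assoc] at h
  exact eq_inv_of_mul_eq_one_left (mul_eq_left.1 h)

/-- The inversion map as a permutation. -/
def invPerm : Equiv.Perm X := ⟨L.inv, L.inv, L.inv_inv, L.inv_inv⟩

theorem invPerm_mul_self : L.invPerm * L.invPerm = 1 := Equiv.ext L.inv_inv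

theorem invPerm_inv : L.invPerm⁻¹ = L.invPerm := inv_eq_of_mul_eq_one_left L.invPerm_mul_self

/-- Conjugation by the inversion map. -/
def tau : Equiv.Perm X ≃* Equiv.Perm X := MulAut.conj L.invPerm

theorem tau_apply (g : Equiv.Perm X) : L.tau g = L.invPerm * g * L.invPerm := by
  simp [tau, invPerm_inv]

theorem tau_rho (x : X) : L.tau (L.rho x) = (L.rho x)⁻¹ := by
  rw [tau_apply, ← rho_inv]
  ext y
  change L.inv (L.mul (L.inv y) x) = L.mul y (L.inv x)
  rw [L.aip, L.inv_inv]

theorem inv_one : L.inv L.one = L.one := by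
  rw [← L.one_mul (L.inv L.one), L.mul_inv]

theorem tau_apply_one {g : Equiv.Perm X} (hg : g L.one = L.one) : L.tau g L.one = L.one := by
  rw [tau_apply]
  change L.inv (g (L.inv L.one)) = L.one
  rw [inv_one, hg, inv_one]

theorem rho_mem (x : X) : L.rho x ∈ L.envGroup := Subgroup.subset_closure ⟨x, rfl⟩

theorem exists_mul_rho_mul_tau_inv {g : Equiv.Perm X} (hg : g ∈ L.envGroup) :
    ∀ x, ∃ y, g * L.rho x * (L.tau g)⁻¹ = L.rho y := by
  suffices h : (∀ x, ∃ y, g * L.rho x * (L.tau g)⁻¹ = L.rho y) ∧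
      ∀ x, ∃ y, g⁻¹ * L.rho x * L.tau g = L.rho y from h.1
  induction hg using Subgroup.closure_induction with
  | mem g hg =>
    obtain ⟨z, rfl⟩ := hg
    exact ⟨fun x => ⟨_, by rw [tau_rho, _root_.inv_inv, rho_mul_rho_mul_rho]⟩,
      fun x => ⟨_, by rw [tau_rho, ← rho_inv, rho_mul_rho_mul_rho]⟩⟩
  | one => exact ⟨fun x => ⟨x, by simp⟩, fun x => ⟨x, by simp⟩⟩
  | mul g h _ _ ihg ihh =>
    refine ⟨fun x => ?_, fun x => ?_⟩
    · obtain ⟨y, hy⟩ := ihh.1 x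
      obtain ⟨z, hz⟩ := ihg.1 y
      exact ⟨z, by rw [← hz, ← hy, map_mul]; group⟩
    · obtain ⟨y, hy⟩ := ihg.2 x
      obtain ⟨z, hz⟩ := ihh.2 y
      exact ⟨z, by rw [← hz, ← hy, map_mul]; group⟩
  | inv g hg ih => simpa [and_comm] using ih

/-- Elements of the enveloping group fixing `1` are automorphisms commuting with inversion. -/
theorem tau_eq_self {h : Equiv.Perm X} (hh : h ∈ L.envGroup) (h1 : h L.one = L.one) :
    L.tau h = h := by
  obtain ⟨y, hy⟩ := L.exists_mul_rho_mul_tau_inv hh L.one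
  rw [rho_one, _root_.mul_one] at hy
  have h2 : (L.tau h)⁻¹ L.one = L.one := by
    rw [Equiv.Perm.inv_eq_iff_eq, L.tau_apply_one h1]
  have h3 := congrArg (· L.one) hy
  simp only [Equiv.Perm.mul_apply, h2, h1, rho_apply_one] at h3
  rw [← h3, rho_one] at hy
  exact (mul_inv_eq_one.1 hy).symm

theorem conj_rho {h : Equiv.Perm X} (hh : h ∈ L.envGroup) (h1 : h L.one = L.one) (x : X) :
    h * L.rho x * h⁻¹ = L.rho (h x) := by
  obtain ⟨y, hy⟩ := L.exists_mul_rho_mul_tau_inv hh x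
  rw [L.tau_eq_self hh h1] at hy
  rw [hy]
  have h3 := congrArg (· L.one) hy
  simp only [Equiv.Perm.mul_apply, Equiv.Perm.inv_eq_iff_eq.2 h1.symm, rho_apply_one] at h3
  rw [h3]

/-- Every `g` in the enveloping group is `ρ_{g 1}` times an inner map. -/
theorem exists_eq_rho_mul {g : Equiv.Perm X} (hg : g ∈ L.envGroup) :
    ∃ h ∈ L.envGroup, h L.one = L.one ∧ g = L.rho (g L.one) * h := by
  refine ⟨(L.rho (g L.one))⁻¹ * g, mul_mem (inv_mem (L.rho_mem _)) hg, ?_, by simp⟩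
  rw [Equiv.Perm.mul_apply, Equiv.Perm.inv_eq_iff_eq, rho_apply_one]

theorem rho_apply_one_sq {g : Equiv.Perm X} (hg : g ∈ L.envGroup) :
    L.rho (g L.one) ^ 2 = g * (L.tau g)⁻¹ := by
  obtain ⟨h, hh, h1, hgh⟩ := L.exists_eq_rho_mul hg
  generalize g L.one = x at hgh
  rw [hgh, map_mul, L.tau_eq_self hh h1, tau_rho, pow_two]
  group

theorem rho_mul_sq (x y : X) :
    L.rho (L.mul x y) ^ 2 = L.rho y * L.rho x ^ 2 * L.rho y := by
  have h := L.rho_apply_one_sq (mul_mem (L.rho_mem y) (L.rho_mem x))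
  rw [Equiv.Perm.mul_apply, rho_apply_one, rho_apply] at h
  rw [h, map_mul, tau_rho, tau_rho, pow_two]
  group

theorem exists_rho_pow (x : X) : ∀ n : ℕ, ∃ y, L.rho x ^ n = L.rho y
  | 0 => ⟨L.one, by rw [pow_zero, rho_one]⟩
  | 1 => ⟨x, pow_one _⟩
  | n + 2 => by
    obtain ⟨y, hy⟩ := exists_rho_pow x n
    exact ⟨L.mul (L.mul x y) x, by rw [← rho_mul_rho_mul_rho, ← hy, ← pow_succ', ← pow_succ]⟩

theorem rho_pow (x : X) (n : ℕ) : L.rho x ^ n = L.rho (L.pow x n) := by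
  have h : ∀ n : ℕ, (L.rho x ^ n) L.one = L.pow x n := by
    intro n
    induction n with
    | zero => rfl
    | succ n ih => rw [pow_succ', Equiv.Perm.mul_apply, ih]; rfl
  obtain ⟨y, hy⟩ := L.exists_rho_pow x n
  rw [hy, ← h n, hy, rho_apply_one]

theorem rho_eq_of_mul {h : Equiv.Perm X} {x y : X} (h1 : h L.one = L.one)
    (hxy : L.rho x = L.rho y * h) : h = 1 := by
  have := congrArg (· L.one) hxy
  simp only [Equiv.Perm.mul_apply, h1, rho_apply_one] at this
  subst this
  exact mul_eq_left.1 hxy.symm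

theorem commute_aux [Finite X] {u : X} (hu : IsOddElt (L.rho u)) (k : ℕ) :
    ∀ z, L.rho z ^ 2 ^ k = 1 →
      Commute (L.rho u) (L.rho z) ∧ L.rho (L.mul z u) = L.rho u * L.rho z := by
  induction k with
  | zero =>
    intro z hz
    rw [pow_zero, pow_one, ← rho_one] at hz
    rw [L.rho_injective hz, L.one_mul, rho_one]
    exact ⟨Commute.one_right _, (_root_.mul_one _).symm⟩
  | succ k ih =>
    intro z hz
    have hz2 : Commute (L.rho u) (L.rho z ^ 2) := by
      rw [rho_pow]
      refine (ih _ ?_).1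
      rwa [← rho_pow, ← pow_mul, ← pow_succ']
    have hw : L.rho (L.mul z u) ^ 2 = L.rho u ^ 2 * L.rho z ^ 2 := by
      rw [rho_mul_sq, mul_assoc, ← hz2.eq, ← mul_assoc, pow_two (L.rho u)]
    have htwo : IsTwoElt (L.rho z ^ 2) := IsTwoElt.pow ⟨_, hz⟩ 2
    obtain ⟨N, hN⟩ := (hu.pow 2).exists_pow_mul_eq htwo (hz2.pow_left 2)
    obtain ⟨n, hn⟩ := hu.exists_pow_pow_two_eq
    have hM : L.rho (L.mul z u) ^ (2 * N * n) = L.rho u := by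
      rw [pow_mul, pow_mul, hw, hN, hn]
    set w := L.mul z u with hwdef
    obtain ⟨m, hm, hum⟩ := hu
    obtain ⟨e, he⟩ : ∃ e : ℕ, L.rho w ^ e = (L.rho u)⁻¹ * L.rho w := by
      refine ⟨2 * N * n * (m - 1) + 1, ?_⟩
      rw [pow_succ, pow_mul, hM]
      congr 1
      refine eq_inv_of_mul_eq_one_left ?_
      rw [← pow_succ, Nat.sub_add_cancel hm.pos, hum]
    obtain ⟨h, hh, h1, hg⟩ := L.exists_eq_rho_mul (mul_mem (L.rho_mem u) (L.rho_mem z))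
    rw [Equiv.Perm.mul_apply, rho_apply_one, rho_apply, ← hwdef] at hg
    rw [rho_pow] at he
    have hz' : L.rho z = L.rho (L.pow w e) * h := by
      rw [he, mul_assoc, ← hg, inv_mul_cancel_left]
    rw [L.rho_eq_of_mul h1 hz', _root_.mul_one] at hg
    refine ⟨?_, hg.symm⟩
    have hc : Commute (L.rho u) (L.rho w) := hM ▸ Commute.pow_self _ _
    rw [← inv_mul_cancel_left (L.rho u) (L.rho z), hg]
    exact (Commute.refl _).inv_right.mul_right hc

variable {L} in
theorem commute_rho [Finite X] {u z : X} (hu : IsOddElt (L.rho u)) (hz : IsTwoElt (L.rho z)) :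
    Commute (L.rho u) (L.rho z) :=
  let ⟨k, hk⟩ := hz
  (L.commute_aux hu k z hk).1

variable {L} in
theorem mul_comm_of_odd_two [Finite X] {u z : X} (hu : IsOddElt (L.rho u))
    (hz : IsTwoElt (L.rho z)) : L.mul u z = L.mul z u := by
  have h := congrArg (· L.one) (commute_rho hu hz).eq
  simpa [rho_apply, L.one_mul] using h.symm

variable {L} in
theorem rho_mul_of_odd_two [Finite X] {u z : X} (hu : IsOddElt (L.rho u))
    (hz : IsTwoElt (L.rho z)) : L.rho (L.mul u z) = L.rho u * L.rho z := by
  rw [mul_comm_of_odd_two hu hz]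
  obtain ⟨k, hk⟩ := hz
  exact (L.commute_aux hu k z hk).2

theorem exists_odd_mul_two [Finite X] (x : X) :
    ∃ u z, IsOddElt (L.rho u) ∧ IsTwoElt (L.rho z) ∧ L.mul u z = x := by
  obtain ⟨i, j, hi, hj, hij⟩ := exists_pow_mul_pow_eq (L.rho x)
  rw [rho_pow] at hi hj
  refine ⟨_, _, hi, hj, L.rho_injective ?_⟩
  rw [rho_mul_of_odd_two hi hj, ← rho_pow, ← rho_pow, hij]

/-- The odd part of an element. -/
noncomputable def oddPart [Finite X] (x : X) : X := (L.exists_odd_mul_two x).choose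

/-- The `2`-part of an element. -/
noncomputable def twoPart [Finite X] (x : X) : X := (L.exists_odd_mul_two x).choose_spec.choose

theorem isOddElt_oddPart [Finite X] (x : X) : IsOddElt (L.rho (L.oddPart x)) :=
  (L.exists_odd_mul_two x).choose_spec.choose_spec.1

theorem isTwoElt_twoPart [Finite X] (x : X) : IsTwoElt (L.rho (L.twoPart x)) :=
  (L.exists_odd_mul_two x).choose_spec.choose_spec.2.1

theorem oddPart_mul_twoPart [Finite X] (x : X) : L.mul (L.oddPart x) (L.twoPart x) = x :=
  (L.exists_odd_mul_two x).choose_spec.choose_spec.2.2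

variable {L} in
theorem odd_eq_and_two_eq_of_mul_eq [Finite X] {u z u' z' : X} (hu : IsOddElt (L.rho u))
    (hz : IsTwoElt (L.rho z)) (hu' : IsOddElt (L.rho u')) (hz' : IsTwoElt (L.rho z'))
    (h : L.mul u z = L.mul u' z') : u = u' ∧ z = z' := by
  have huu : u = u' := by
    refine L.rho_injective (hu.eq_of_mul_eq_mul hz (commute_rho hu hz) hu' hz'
      (commute_rho hu' hz') ?_)
    rw [← rho_mul_of_odd_two hu hz, h, rho_mul_of_odd_two hu' hz']
  subst huu
  exact ⟨rfl, (L.mulLeft_bijective u).1 h⟩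

theorem rho_sq_eq [Finite X] (x : X) :
    L.rho x ^ 2 = L.rho (L.oddPart x) ^ 2 * L.rho (L.twoPart x) ^ 2 := by
  have h := commute_rho (L.isOddElt_oddPart x) (L.isTwoElt_twoPart x)
  rw [← h.mul_pow, ← rho_mul_of_odd_two (L.isOddElt_oddPart x) (L.isTwoElt_twoPart x),
    oddPart_mul_twoPart]

/-- The group generated by the right translations of odd order. -/
noncomputable def oddGroup : Subgroup (Equiv.Perm X) :=
  Subgroup.closure (L.rho '' {x | IsOddElt (L.rho x)})

theorem rho_mem_oddGroup {x : X} (hx : IsOddElt (L.rho x)) : L.rho x ∈ L.oddGroup :=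
  Subgroup.subset_closure ⟨x, hx, rfl⟩

theorem oddGroup_le : L.oddGroup ≤ L.envGroup :=
  Subgroup.closure_mono (Set.image_subset_range _ _)

theorem tau_mem_oddGroup {g : Equiv.Perm X} (hg : g ∈ L.oddGroup) : L.tau g ∈ L.oddGroup := by
  have h : L.oddGroup ≤ L.oddGroup.comap L.tau.toMonoidHom := by
    refine (Subgroup.closure_le _).2 ?_
    rintro _ ⟨x, hx, rfl⟩
    change L.tau (L.rho x) ∈ L.oddGroup
    rw [tau_rho]
    exact inv_mem (L.rho_mem_oddGroup hx)
  exact h hg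

variable {L} in
theorem commute_oddGroup [Finite X] {g : Equiv.Perm X} (hg : g ∈ L.oddGroup) {z : X}
    (hz : IsTwoElt (L.rho z)) : Commute g (L.rho z) := by
  have h : L.oddGroup ≤ Subgroup.centralizer {L.rho z} := by
    refine (Subgroup.closure_le _).2 ?_
    rintro _ ⟨x, hx, rfl⟩
    exact Subgroup.mem_centralizer_singleton_iff.2 (commute_rho hx hz)
  exact Subgroup.mem_centralizer_singleton_iff.1 (h hg)

variable {L} in
theorem isTwoElt_rho_mul_of_isTwoElt_sq [Finite X] {a b : X}
    (h : IsTwoElt (L.rho a ^ 2 * L.rho b ^ 2)) : IsTwoElt (L.rho (L.mul a b)) := by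
  refine IsTwoElt.of_pow_two ?_
  rw [rho_mul_sq]
  convert h.conj (L.rho b) using 1
  group

/-- The elements of `2`-power order in the orbit of `1` under the group generated by the right
translations of odd order. -/
def twoCore : Set X := {z | IsTwoElt (L.rho z) ∧ ∃ w ∈ L.oddGroup, w L.one = z}

variable {L} in
theorem rho_sq_mem_oddGroup {z : X} (hz : z ∈ L.twoCore) : L.rho z ^ 2 ∈ L.oddGroup := by
  obtain ⟨-, w, hw, rfl⟩ := hz
  rw [L.rho_apply_one_sq (L.oddGroup_le hw)]
  exact mul_mem hw (inv_mem (L.tau_mem_oddGroup hw))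

variable {L} in
theorem mul_mem_twoCore [Finite X] {a b : X} (ha : a ∈ L.twoCore) (hb : b ∈ L.twoCore) :
    L.mul a b ∈ L.twoCore := by
  refine ⟨isTwoElt_rho_mul_of_isTwoElt_sq ((ha.1.pow 2).mul_of_commute (hb.1.pow 2)
    ((commute_oddGroup (rho_sq_mem_oddGroup ha) hb.1).pow_right 2)), ?_⟩
  obtain ⟨-, w, hw, rfl⟩ := ha
  obtain ⟨hb2, w', hw', hwb⟩ := hb
  refine ⟨w * w', mul_mem hw hw', ?_⟩
  have h := congrArg (· L.one) (commute_oddGroup hw hb2).eq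
  simpa only [Equiv.Perm.mul_apply, L.one_mul, rho_apply, hwb] using h

variable {L} in
/-- Inner maps arising from products in `L.twoCore` act trivially on it. -/
theorem rho_mul_rho_apply [Finite X] {a b c : X} (ha : a ∈ L.twoCore) (hb : b ∈ L.twoCore)
    (hc : c ∈ L.twoCore) : L.rho c (L.rho b a) = L.rho (L.mul b c) a := by
  obtain ⟨h, hh, h1, hg⟩ := L.exists_eq_rho_mul (mul_mem (L.rho_mem c) (L.rho_mem b))
  rw [Equiv.Perm.mul_apply, rho_apply_one, rho_apply] at hg
  obtain ⟨-, w, hw, rfl⟩ := ha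
  have hd := (mul_mem_twoCore hb hc).1
  have hcomm : Commute w h := by
    have : h = (L.rho (L.mul b c))⁻¹ * (L.rho c * L.rho b) := by rw [hg]; group
    rw [this]
    exact (commute_oddGroup hw hd).inv_right.mul_right
      ((commute_oddGroup hw hc.1).mul_right (commute_oddGroup hw hb.1))
  have hfix : h (w L.one) = w L.one := by
    rw [← Equiv.Perm.mul_apply, ← hcomm.eq, Equiv.Perm.mul_apply, h1]
  rw [← Equiv.Perm.mul_apply, hg, Equiv.Perm.mul_apply, hfix]

variable {L} in
theorem mul_assoc_twoCore [Finite X] {a b c : X} (ha : a ∈ L.twoCore) (hb : b ∈ L.twoCore)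
    (hc : c ∈ L.twoCore) : L.mul (L.mul a b) c = L.mul a (L.mul b c) :=
  rho_mul_rho_apply ha hb hc

variable {L} in
theorem mul_comm_twoCore [Finite X] {a b : X} (ha : a ∈ L.twoCore) (hb : b ∈ L.twoCore) :
    L.mul a b = L.mul b a := by
  obtain ⟨h, hh, h1, hg⟩ := L.exists_eq_rho_mul (mul_mem (L.rho_mem b) (L.rho_mem a))
  rw [Equiv.Perm.mul_apply, rho_apply_one, rho_apply] at hg
  have htau := congrArg L.tau hg
  simp only [map_mul, tau_rho, L.tau_eq_self hh h1] at htau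
  have hg' : h * (L.rho a * L.rho b) = L.rho (L.mul a b) := by
    have : h = L.rho (L.mul a b) * ((L.rho b)⁻¹ * (L.rho a)⁻¹) := by rw [htau]; group
    rw [this]; group
  have h2 := congrArg (· L.one) hg'
  simp only [Equiv.Perm.mul_apply, L.one_mul, rho_apply] at h2
  obtain ⟨hba2, w, hw, hwba⟩ := mul_mem_twoCore hb ha
  have hcomm : Commute w h := by
    have : h = (L.rho (L.mul a b))⁻¹ * (L.rho b * L.rho a) := by rw [hg]; group
    rw [this]
    exact (commute_oddGroup hw (mul_mem_twoCore ha hb).1).inv_right.mul_right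
      ((commute_oddGroup hw hb.1).mul_right (commute_oddGroup hw ha.1))
  rw [← h2, ← hwba, ← Equiv.Perm.mul_apply, ← hcomm.eq, Equiv.Perm.mul_apply, h1]

theorem one_mem_twoCore : L.one ∈ L.twoCore :=
  ⟨by rw [rho_one]; exact isTwoElt_one, 1, one_mem _, rfl⟩

/-- On `L.twoCore` the loop operation is a commutative monoid. -/
noncomputable instance twoCoreCommMonoid [Finite X] : CommMonoid L.twoCore where
  mul a b := ⟨L.mul a b, mul_mem_twoCore a.2 b.2⟩
  one := ⟨L.one, L.one_mem_twoCore⟩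
  mul_assoc a b c := Subtype.ext (mul_assoc_twoCore a.2 b.2 c.2)
  mul_comm a b := Subtype.ext (mul_comm_twoCore a.2 b.2)
  one_mul a := Subtype.ext (L.one_mul a)
  mul_one a := Subtype.ext (L.mul_one a)

theorem coe_mul_twoCore [Finite X] (a b : L.twoCore) : ((a * b : L.twoCore) : X) = L.mul a b := rfl

theorem coe_one_twoCore [Finite X] : ((1 : L.twoCore) : X) = L.one := rfl

theorem coe_pow_twoCore [Finite X] (a : L.twoCore) (n : ℕ) :
    ((a ^ n : L.twoCore) : X) = L.pow a n := by
  induction n with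
  | zero => rw [pow_zero]; rfl
  | succ n ih => rw [pow_succ, coe_mul_twoCore, ih]; rfl

theorem isTwoElt_twoCore [Finite X] (a : L.twoCore) : IsTwoElt a := by
  obtain ⟨k, hk⟩ := a.2.1
  refine ⟨k, Subtype.ext (L.rho_injective ?_)⟩
  rw [coe_pow_twoCore, coe_one_twoCore, ← rho_pow, hk, rho_one]

variable {L} in
theorem twoPart_mem_twoCore [Finite X] {w : Equiv.Perm X} (hw : w ∈ L.oddGroup) :
    L.twoPart (w L.one) ∈ L.twoCore := by
  refine ⟨L.isTwoElt_twoPart _, (L.rho (L.oddPart (w L.one)))⁻¹ * w,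
    mul_mem (inv_mem (L.rho_mem_oddGroup (L.isOddElt_oddPart _))) hw, ?_⟩
  rw [Equiv.Perm.mul_apply, Equiv.Perm.inv_eq_iff_eq, rho_apply,
    ← mul_comm_of_odd_two (L.isOddElt_oddPart _) (L.isTwoElt_twoPart _), oddPart_mul_twoPart]

variable {L} in
theorem twoPart_mul_mem_twoCore [Finite X] {x y : X} (hx : IsOddElt (L.rho x))
    (hy : IsOddElt (L.rho y)) : L.twoPart (L.mul x y) ∈ L.twoCore := by
  have h := twoPart_mem_twoCore (mul_mem (L.rho_mem_oddGroup hy) (L.rho_mem_oddGroup hx))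
  rwa [Equiv.Perm.mul_apply, rho_apply_one] at h

variable {L} in
theorem odd_mul_mul [Finite X] {u a b : X} (hu : IsOddElt (L.rho u)) (ha : IsTwoElt (L.rho a))
    (hb : IsTwoElt (L.rho b)) (hab : IsTwoElt (L.rho (L.mul a b))) :
    L.mul (L.mul u a) b = L.mul u (L.mul a b) := by
  have h := congrArg (· L.one) ((commute_rho hu hb).mul_right (commute_rho hu ha)).eq
  simp only [Equiv.Perm.mul_apply, L.one_mul, rho_apply] at h
  rw [← h, mul_comm_of_odd_two hu hab]

variable {L} in
theorem mul_mul_right_comm [Finite X] {u z : X} (hu : IsOddElt (L.rho u))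
    (hz : IsTwoElt (L.rho z)) (x : X) : L.mul (L.mul x z) u = L.mul (L.mul x u) z :=
  congrArg (· x) (commute_rho hu hz).eq

/-- The elements of odd order. -/
def oddSet : Set X := {x | IsOddElt (L.rho x)}

/-- The elements of `2`-power order. -/
def twoSet : Set X := {x | IsTwoElt (L.rho x)}

theorem one_mem_oddSet : L.one ∈ L.oddSet := by
  change IsOddElt (L.rho L.one)
  rw [rho_one]
  exact isOddElt_one

theorem inv_mem_oddSet {x : X} (hx : x ∈ L.oddSet) : L.inv x ∈ L.oddSet := by
  change IsOddElt (L.rho (L.inv x))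
  rw [rho_inv]
  exact hx.inv

theorem pow_mem_oddSet {x : X} (hx : x ∈ L.oddSet) (n : ℕ) : L.pow x n ∈ L.oddSet := by
  change IsOddElt (L.rho (L.pow x n))
  rw [← rho_pow]
  exact hx.pow n

theorem odd_card_oddSet [Finite X] : Odd (Nat.card L.oddSet) := by
  classical
  have := Fintype.ofFinite L.oddSet
  let J : Function.End L.oddSet := fun x => ⟨L.inv x, L.inv_mem_oddSet x.2⟩
  have hJ : Function.Involutive J := fun x => Subtype.ext (L.inv_inv x)
  have h := Equiv.Perm.card_fixedPoints_modEq (f := J) (p := 2) (n := 1)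
    (by rw [pow_one, pow_two]; exact funext hJ)
  have hfix : Fintype.card (Function.fixedPoints J) = 1 := by
    rw [Fintype.card_eq_one_iff]
    refine ⟨⟨⟨L.one, L.one_mem_oddSet⟩, Subtype.ext L.inv_one⟩, ?_⟩
    rintro ⟨⟨x, m, hm, hxm⟩, hx⟩
    have hx : L.inv x = x := congrArg Subtype.val hx
    have h2 : L.rho x ^ 2 = 1 := by
      nth_rw 1 [pow_two, ← hx, rho_inv, inv_mul_cancel]
    refine Subtype.ext (Subtype.ext (L.rho_injective ?_))
    rw [rho_one]
    exact IsTwoElt.eq_one_of_odd_pow ⟨1, by rwa [pow_one]⟩ hm hxm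
  rw [Nat.card_eq_fintype_card, Nat.odd_iff]
  exact h.trans (congrArg (· % 2) hfix)

/-- The odd part of a product of elements of odd order. -/
noncomputable def oddMul [Finite X] (x y : L.oddSet) : L.oddSet :=
  ⟨L.oddPart (L.mul x y), L.isOddElt_oddPart _⟩

/-- The `2`-part of a product of elements of odd order. -/
noncomputable def cocycle [Finite X] (x y : L.oddSet) : L.twoCore :=
  ⟨L.twoPart (L.mul x y), twoPart_mul_mem_twoCore x.2 y.2⟩

theorem mul_oddMul_cocycle [Finite X] (x y : L.oddSet) :
    L.mul (L.oddMul x y) (L.cocycle x y) = L.mul x y :=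
  L.oddPart_mul_twoPart _

variable {L} in
theorem eq_and_eq_of_mul_eq [Finite X] {u u' : L.oddSet} {z z' : L.twoCore}
    (h : L.mul u z = L.mul u' z') : u = u' ∧ z = z' := by
  have := odd_eq_and_two_eq_of_mul_eq u.2 z.2.1 u'.2 z'.2.1 h
  exact ⟨Subtype.ext this.1, Subtype.ext this.2⟩

theorem odd_mul_mul_twoCore [Finite X] (u : L.oddSet) (a b : L.twoCore) :
    L.mul (L.mul u a) b = L.mul u (a * b : L.twoCore) :=
  odd_mul_mul u.2 a.2.1 b.2.1 (a * b).2.1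

theorem mul_cocycle_mul_cocycle [Finite X] (x y : L.oddSet) :
    ∃ σ : Equiv.Perm L.oddSet, ∀ p, L.cocycle p x * L.cocycle (L.oddMul p x) y =
      L.cocycle (σ p) (L.oddMul x y) * L.cocycle x y := by
  obtain ⟨h, hh, h1, hg⟩ := L.exists_eq_rho_mul (mul_mem (L.rho_mem y) (L.rho_mem x))
  rw [Equiv.Perm.mul_apply, rho_apply_one, rho_apply] at hg
  have hodd : ∀ p ∈ L.oddSet, h p ∈ L.oddSet := fun p hp => by
    change IsOddElt (L.rho (h p))
    rw [← L.conj_rho hh h1]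
    exact hp.conj h
  let f : L.oddSet → L.oddSet := fun p => ⟨h p, hodd p p.2⟩
  have hf : Function.Injective f := fun p q hpq =>
    Subtype.ext (h.injective (congrArg Subtype.val hpq))
  refine ⟨Equiv.ofBijective f (Finite.injective_iff_bijective.1 hf), fun p => ?_⟩
  have hp : L.mul (L.mul p x) y = L.mul (f p) (L.mul x y) := congrArg (· (p : X)) hg
  rw [← L.mul_oddMul_cocycle p x, mul_mul_right_comm y.2 (L.cocycle p x).2.1,
    ← L.mul_oddMul_cocycle _ y, odd_mul_mul_twoCore, ← L.mul_oddMul_cocycle x y,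
    ← rho_apply L _ (f p : X),
    rho_mul_of_odd_two (L.oddMul x y).2 (L.cocycle x y).2.1,
    (commute_rho (L.oddMul x y).2 (L.cocycle x y).2.1).eq, Equiv.Perm.mul_apply, rho_apply,
    rho_apply, ← L.mul_oddMul_cocycle (f p), odd_mul_mul_twoCore] at hp
  rw [mul_comm (L.cocycle p x)]
  exact (eq_and_eq_of_mul_eq hp).2

theorem oddMul_bijective [Finite X] (x : L.oddSet) :
    Function.Bijective fun p => L.oddMul p x := by
  let x' : L.oddSet := ⟨L.inv x, L.inv_mem_oddSet x.2⟩
  refine Finite.injective_iff_bijective.1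
    (Function.LeftInverse.injective (g := fun c => L.oddMul c x') fun p => ?_)
  have h : L.mul (L.mul p x) x' = L.mul p (1 : L.twoCore) := by
    rw [coe_one_twoCore, L.mul_one, ← rho_apply, ← rho_apply, rho_inv]
    exact Equiv.symm_apply_apply _ _
  rw [← mul_oddMul_cocycle, mul_mul_right_comm x'.2 (L.cocycle p x).2.1, ← mul_oddMul_cocycle,
    odd_mul_mul_twoCore] at h
  exact (eq_and_eq_of_mul_eq h).1

theorem exists_mul_eq_mul_cocycle_pow [Finite X] : ∃ P : L.oddSet → L.twoCore,
    ∀ x y, P x * P y = P (L.oddMul x y) * L.cocycle x y ^ Nat.card L.oddSet := by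
  have := Fintype.ofFinite L.oddSet
  refine ⟨fun x => ∏ p, L.cocycle p x, fun x y => ?_⟩
  obtain ⟨σ, hσ⟩ := L.mul_cocycle_mul_cocycle x y
  dsimp only
  rw [← (L.oddMul_bijective x).prod_comp fun q => L.cocycle q y, ← Finset.prod_mul_distrib,
    Finset.prod_congr rfl fun p _ => hσ p, Finset.prod_mul_distrib,
    Equiv.prod_comp σ fun p => L.cocycle p (L.oddMul x y),
    Finset.prod_const, Finset.card_univ, Nat.card_eq_fintype_card]

theorem cocycle_eq_one [Finite X] (x y : L.oddSet) : L.cocycle x y = 1 := by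
  obtain ⟨P, hP⟩ := L.exists_mul_eq_mul_cocycle_pow
  have hmul : ∀ x y v : L.oddSet, L.mul x y = v → P x * P y = P v := by
    intro x y v h
    have h' : L.mul (L.oddMul x y) (L.cocycle x y) = L.mul v (1 : L.twoCore) := by
      rw [mul_oddMul_cocycle, h, coe_one_twoCore, L.mul_one]
    obtain ⟨h1, h2⟩ := eq_and_eq_of_mul_eq h'
    rw [hP, h1, h2, one_pow, _root_.mul_one]
  let e : L.oddSet := ⟨L.one, L.one_mem_oddSet⟩
  have he : P e = 1 := by
    have h := congrArg Subtype.val (hmul e e e (L.one_mul _))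
    rw [coe_mul_twoCore] at h
    exact Subtype.ext ((L.mulLeft_bijective _).1 (h.trans (L.mul_one _).symm))
  have hone : ∀ x, P x = 1 := by
    intro x
    have hpow : ∀ n, P ⟨L.pow x n, L.pow_mem_oddSet x.2 n⟩ = P x ^ n := by
      intro n
      induction n with
      | zero => rw [pow_zero]; exact he
      | succ n ih => rw [pow_succ, ← ih]; exact (hmul _ _ _ rfl).symm
    obtain ⟨m, hm, hxm⟩ := x.2
    refine (L.isTwoElt_twoCore (P x)).eq_one_of_odd_pow hm ?_
    rw [← hpow, ← he]
    congr 1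
    refine Subtype.ext (L.rho_injective ?_)
    rw [← rho_pow, hxm, rho_one]
  have h := hP x y
  rw [hone, hone, hone, _root_.one_mul, _root_.one_mul] at h
  exact (L.isTwoElt_twoCore _).eq_one_of_odd_pow L.odd_card_oddSet h.symm

variable {L} in
theorem mul_mem_oddSet [Finite X] {x y : X} (hx : x ∈ L.oddSet) (hy : y ∈ L.oddSet) :
    L.mul x y ∈ L.oddSet := by
  have h := L.mul_oddMul_cocycle ⟨x, hx⟩ ⟨y, hy⟩
  rw [cocycle_eq_one, coe_one_twoCore, L.mul_one] at h
  exact h ▸ (L.oddMul ⟨x, hx⟩ ⟨y, hy⟩).2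

theorem rho_mem_normalizer_oddGroup [Finite X] (x : X) :
    L.rho x ∈ Subgroup.normalizer (L.oddGroup : Set (Equiv.Perm X)) := by
  rw [← L.oddPart_mul_twoPart x,
    rho_mul_of_odd_two (L.isOddElt_oddPart x) (L.isTwoElt_twoPart x)]
  refine mul_mem (Subgroup.le_normalizer (L.rho_mem_oddGroup (L.isOddElt_oddPart x))) ?_
  refine Subgroup.centralizer_le_normalizer _ (Subgroup.mem_centralizer_iff.2 fun g hg => ?_)
  exact commute_oddGroup hg (L.isTwoElt_twoPart x)

theorem invPerm_mem_normalizer_oddGroup [Finite X] :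
    L.invPerm ∈ Subgroup.normalizer (L.oddGroup : Set (Equiv.Perm X)) := by
  rw [← Subgroup.closure_eq L.oddGroup]
  refine Subgroup.mem_normalizer_closure_of_conj_mem fun g hg => ?_
  exact L.tau_mem_oddGroup hg

theorem exists_pow_mem_oddGroup [Finite X] (x : X) :
    ∃ k : ℕ, (L.rho x ^ 2) ^ 2 ^ k ∈ L.oddGroup := by
  obtain ⟨k, hk⟩ := (L.isTwoElt_twoPart x).pow 2
  refine ⟨k, ?_⟩
  rw [rho_sq_eq, ((commute_rho (L.isOddElt_oddPart x) (L.isTwoElt_twoPart x)).pow_pow 2 2).mul_pow,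
    hk, _root_.mul_one]
  exact pow_mem (pow_mem (L.rho_mem_oddGroup (L.isOddElt_oddPart x)) _) _

theorem exists_pow_mem_oddGroup_of_mem_closure [Finite X] {g : Equiv.Perm X}
    (hg : g ∈ Subgroup.closure (Set.range fun x => L.rho x ^ 2)) :
    ∃ k : ℕ, g ^ 2 ^ k ∈ L.oddGroup := by
  let A := Subgroup.normalizer (L.oddGroup : Set (Equiv.Perm X))
  let r : X → A := fun x => ⟨L.rho x, L.rho_mem_normalizer_oddGroup x⟩
  let J : A := ⟨L.invPerm, L.invPerm_mem_normalizer_oddGroup⟩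
  let π : A →* A ⧸ L.oddGroup.subgroupOf A := QuotientGroup.mk' _
  have hJJ : J * J = 1 := Subtype.ext L.invPerm_mul_self
  have hJi : J⁻¹ = J := inv_eq_of_mul_eq_one_left hJJ
  have hJr : ∀ x, J * r x * J = (r x)⁻¹ := fun x => Subtype.ext (by
    have := L.tau_rho x
    rwa [tau_apply] at this)
  have hJr2 : ∀ x, J * r x ^ 2 * J = (r x ^ 2)⁻¹ := fun x => by
    rw [← inv_pow, ← hJr, pow_two, pow_two]
    simp only [mul_assoc]
    rw [← mul_assoc J J, hJJ, _root_.one_mul]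
  have hsemi : ∀ x, SemiconjBy J (r x ^ 2) (r x ^ 2)⁻¹ := fun x => by
    rw [SemiconjBy, ← hJr2, mul_assoc _ J J, hJJ, _root_.mul_one]
  have hr1 : r L.one = 1 := Subtype.ext L.rho_one
  have hπ : ∀ a : A, π a = 1 ↔ (a : Equiv.Perm X) ∈ L.oddGroup := fun a => by
    rw [QuotientGroup.mk'_apply, QuotientGroup.eq_one_iff, Subgroup.mem_subgroupOf]
  have hP : IsPGroup 2 (Subgroup.closure (Set.range fun x => π (J * r x ^ 2))) := by
    apply Subgroup.isPGroup_closure_of_involutions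
    · rintro _ ⟨x, rfl⟩ _ ⟨y, rfl⟩
      refine ⟨(L.rho x ^ 2 * (L.rho y)⁻¹) L.one, ?_⟩
      have h : r ((L.rho x ^ 2 * (L.rho y)⁻¹) L.one) ^ 2 =
          r x ^ 2 * (r y ^ 2)⁻¹ * r x ^ 2 := by
        refine Subtype.ext ?_
        change L.rho ((L.rho x ^ 2 * (L.rho y)⁻¹) L.one) ^ 2 =
          L.rho x ^ 2 * (L.rho y ^ 2)⁻¹ * L.rho x ^ 2
        rw [L.rho_apply_one_sq (mul_mem (pow_mem (L.rho_mem x) 2) (inv_mem (L.rho_mem y))),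
          map_mul, map_pow, map_inv, tau_rho, tau_rho, pow_two (L.rho y)]
        group
      have hx := hsemi x
      have h2 := ((hx.mul_right (hsemi y).inv_right).mul_right hx).eq
      rw [_root_.inv_inv] at h2
      dsimp only
      rw [← map_mul, ← map_inv, ← map_mul, h, h2, hx.eq, mul_inv_rev, _root_.inv_inv, hJi, hx.eq]
      simp only [mul_assoc]
      rw [← mul_assoc J J, hJJ, _root_.one_mul]
    · rintro _ ⟨x, rfl⟩
      dsimp only
      rw [← map_mul, ← mul_assoc, hJr2, inv_mul_cancel, map_one]
    · rintro _ ⟨x, rfl⟩ _ ⟨y, rfl⟩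
      obtain ⟨k, hk⟩ := L.exists_pow_mem_oddGroup (L.mul (L.inv x) y)
      refine ⟨k, ?_⟩
      dsimp only
      rw [← map_mul, ← map_pow]
      have h : J * r x ^ 2 * (J * r y ^ 2) = (r y)⁻¹ * r (L.mul (L.inv x) y) ^ 2 * r y := by
        rw [← mul_assoc, hJr2]
        refine Subtype.ext ?_
        change (L.rho x ^ 2)⁻¹ * L.rho y ^ 2 =
          (L.rho y)⁻¹ * L.rho (L.mul (L.inv x) y) ^ 2 * L.rho y
        rw [rho_mul_sq, rho_inv, pow_two (L.rho y)]
        group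
      have h' := conj_pow (i := 2 ^ k) (a := (r y)⁻¹) (b := r (L.mul (L.inv x) y) ^ 2)
      rw [_root_.inv_inv] at h'
      rw [h, h', map_mul, map_mul, (hπ ((r (L.mul (L.inv x) y) ^ 2) ^ 2 ^ k)).2 hk, _root_.mul_one,
        ← map_mul, inv_mul_cancel, map_one]
  have hle : Subgroup.closure (Set.range fun x => L.rho x ^ 2) ≤
      ((Subgroup.closure (Set.range fun x => π (J * r x ^ 2))).comap π).map A.subtype := by
    refine (Subgroup.closure_le _).2 ?_
    rintro _ ⟨x, rfl⟩
    refine ⟨r x ^ 2, ?_, rfl⟩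
    have h := mul_mem (Subgroup.subset_closure (Set.mem_range_self L.one))
      (Subgroup.subset_closure (Set.mem_range_self (f := fun x => π (J * r x ^ 2)) x))
    rwa [← map_mul, hr1, one_pow, _root_.mul_one, ← mul_assoc, hJJ, _root_.one_mul] at h
  obtain ⟨a, ha, rfl⟩ := hle hg
  obtain ⟨k, hk⟩ := hP ⟨π a, ha⟩
  refine ⟨k, (hπ (a ^ 2 ^ k)).1 ?_⟩
  rw [map_pow]
  exact congrArg Subtype.val hk

variable {L} in
theorem mul_mem_twoSet [Finite X] {a b : X} (ha : a ∈ L.twoSet) (hb : b ∈ L.twoSet) :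
    L.mul a b ∈ L.twoSet := by
  let M := Subgroup.closure ((fun x => L.rho x ^ 2) '' L.twoSet)
  have hM : ∀ g : M, ∃ k : ℕ, g ^ 2 ^ k ∈ Subgroup.center M := by
    intro g
    obtain ⟨k, hk⟩ := L.exists_pow_mem_oddGroup_of_mem_closure
      (Subgroup.closure_mono (Set.image_subset_range _ _) g.2)
    refine ⟨k, Subgroup.mem_center_iff.2 fun m => Subtype.ext ?_⟩
    have hle : M ≤ Subgroup.centralizer {(g : Equiv.Perm X) ^ 2 ^ k} := by
      refine (Subgroup.closure_le _).2 ?_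
      rintro _ ⟨x, hx, rfl⟩
      exact Subgroup.mem_centralizer_singleton_iff.2 ((commute_oddGroup hk hx).symm.pow_left 2).eq
    exact Subgroup.mem_centralizer_singleton_iff.1 (hle m.2)
  let s : ∀ x ∈ L.twoSet, M := fun x hx => ⟨L.rho x ^ 2, Subgroup.subset_closure ⟨x, hx, rfl⟩⟩
  have hs : ∀ x hx, ∃ k : ℕ, s x hx ^ 2 ^ k = 1 := fun x hx =>
    let ⟨k, hk⟩ := IsTwoElt.pow hx 2
    ⟨k, Subtype.ext hk⟩
  obtain ⟨k, hk⟩ := exists_mul_pow_two_pow_eq_one hM (hs a ha) (hs b hb)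
  exact isTwoElt_rho_mul_of_isTwoElt_sq ⟨k, congrArg Subtype.val hk⟩

end BruckLoop

/-- A finite Bruck loop `X` is the direct product of a subloop `Y` of odd order and a
subloop `Z` of 2-power exponent: `(y, z) ↦ y∘z` is a bijection `Y × Z → X` and
`(y₁∘z₁)∘(y₂∘z₂) = (y₁∘y₂)∘(z₁∘z₂)`. -/
theorem BruckLoop.direct_product_decomposition {X : Type*} [Fintype X] (L : BruckLoop X) :
    ∃ Y Z : Set X, L.IsSubloop Y ∧ L.IsSubloop Z ∧
      Odd (Nat.card Y) ∧ (∀ z ∈ Z, L.OrderTwoPow z) ∧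
      Function.Bijective (fun p : Y × Z => L.mul p.1 p.2) ∧
      ∀ y₁ ∈ Y, ∀ y₂ ∈ Y, ∀ z₁ ∈ Z, ∀ z₂ ∈ Z,
        L.mul (L.mul y₁ z₁) (L.mul y₂ z₂) = L.mul (L.mul y₁ y₂) (L.mul z₁ z₂) := by
  refine ⟨L.oddSet, L.twoSet, ⟨⟨_, L.one_mem_oddSet⟩, fun a ha b hb => mul_mem_oddSet ha hb⟩,
    ⟨⟨_, L.one_mem_twoCore.1⟩, fun a ha b hb => mul_mem_twoSet ha hb⟩, L.odd_card_oddSet,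
    ?_, ⟨?_, ?_⟩, ?_⟩
  · rintro z ⟨k, hk⟩
    refine ⟨k, L.rho_injective ?_⟩
    rw [← rho_pow, hk, rho_one]
  · rintro ⟨y, z⟩ ⟨y', z'⟩ h
    obtain ⟨h1, h2⟩ := odd_eq_and_two_eq_of_mul_eq y.2 z.2 y'.2 z'.2 h
    exact Prod.ext (Subtype.ext h1) (Subtype.ext h2)
  · intro x
    obtain ⟨y, z, hy, hz, h⟩ := L.exists_odd_mul_two x
    exact ⟨(⟨y, hy⟩, ⟨z, hz⟩), h⟩
  · intro y₁ hy₁ y₂ hy₂ z₁ hz₁ z₂ hz₂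
    have h : L.mul (L.mul y₁ z₁) (L.mul y₂ z₂) = L.mul (L.mul (L.mul y₁ z₁) y₂) z₂ := by
      rw [← rho_apply, rho_mul_of_odd_two hy₂ hz₂, (commute_rho hy₂ hz₂).eq]
      rfl
    rw [h, mul_mul_right_comm hy₂ hz₁,
      odd_mul_mul (mul_mem_oddSet hy₁ hy₂) hz₁ hz₂ (mul_mem_twoSet hz₁ hz₂)]
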